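/- arXiv:math/9904147 — 8 statements merged into one kernel-verified Lean document; each statement's English description precedes it below -/
import Mathlib

section
/- Let g ≥ 3 and s, d' be integers with 1 ≤ s ≤ g−1, d' ≥ η̂(s) and g−1 ≤ d' ≤ min(s+g−2, 2g−3). Set d₁ = 2g−3−d' and s₁ = s+g−2−d'. Then U_{d',s}(BGN) ∩ R = {(μ,λ) ∈ ℝ² : d₁ ≤ μ < d₁+1, 0 < λ ≤ (1 − s/g)(μ−d₁) + s₁} \ {(d₁, s₁)}. -/
/-- The region BGN = {(μ,λ) : 0 < μ ≤ 1, 0 < λ ≤ (μ+g−1)/g} \ {(1,1)}. -/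
def BGN (g : ℝ) : Set (ℝ × ℝ) :=
  {p | 0 < p.1 ∧ p.1 ≤ 1 ∧ 0 < p.2 ∧ p.2 ≤ (p.1 + g - 1) / g} \ {((1 : ℝ), (1 : ℝ))}

/-- The region M = {(μ,λ) : 1 < μ < 2, 0 < λ ≤ (μ+g−1)/g} ∪ {(2,λ) : 0 < λ < 1}. -/
def Mreg (g : ℝ) : Set (ℝ × ℝ) :=
  {p | 1 < p.1 ∧ p.1 < 2 ∧ 0 < p.2 ∧ p.2 ≤ (p.1 + g - 1) / g} ∪
    {p | p.1 = 2 ∧ 0 < p.2 ∧ p.2 < 1}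

/-- The pentagonal region P = {(μ,λ) : μ < λ+g−1, μ ≥ 2λ−2, 0 ≤ μ ≤ 2g−2, λ > 0}. -/
def Preg (g : ℝ) : Set (ℝ × ℝ) :=
  {p | p.1 < p.2 + g - 1 ∧ 2 * p.2 - 2 ≤ p.1 ∧ 0 ≤ p.1 ∧ p.1 ≤ 2 * g - 2 ∧ 0 < p.2}

/-- The region R = {(μ,λ) ∈ P : μ ≤ g−1}. -/
def Rreg (g : ℝ) : Set (ℝ × ℝ) := {p ∈ Preg g | p.1 ≤ g - 1}

/-- The affine map T_{d',s}(μ,λ) = (μ+d', sλ). -/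
def Tmap (d' : ℝ) (s : ℤ) (p : ℝ × ℝ) : ℝ × ℝ := (p.1 + d', (s : ℝ) * p.2)

/-- The Serre duality map σ(μ,λ) = (2g−2−μ, λ+g−1−μ). -/
def serre (g : ℝ) (p : ℝ × ℝ) : ℝ × ℝ := (2 * g - 2 - p.1, p.2 + g - 1 - p.1)

/-- The map U_{d',s} = σ ∘ T_{d',s}. -/
def Umap (g d' : ℝ) (s : ℤ) (p : ℝ × ℝ) : ℝ × ℝ := serre g (Tmap d' s p)

/-- η(s) = (s−1)(s+g)/s. -/
def eta (g s : ℤ) : ℚ := ((s : ℚ) - 1) * ((s : ℚ) + (g : ℚ)) / (s : ℚ)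

/-- η̂(s) = ⌈η(s)⌉. -/
def etaHat (g s : ℤ) : ℤ := ⌈eta g s⌉

/-- The bound `2s - 2 ≤ d'` that follows from `η̂(s) ≤ d'`. -/
lemma two_mul_sub_two_le_of_etaHat_le {g s d' : ℤ} (hs : 1 ≤ s) (hs' : s ≤ g - 1)
    (hd' : etaHat g s ≤ d') : 2 * s - 2 ≤ d' := by
  have hsq : (0 : ℚ) < (s : ℚ) := by exact_mod_cast hs
  have h : (s - 1) * (s + g) ≤ d' * s := by
    have h1 : eta g s ≤ (d' : ℚ) := Int.ceil_le.mp hd'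
    rw [eta, div_le_iff₀ hsq] at h1
    exact_mod_cast h1
  by_contra! hlt
  nlinarith [mul_le_mul_of_nonneg_right (show d' ≤ 2 * s - 3 by lia) (show 0 ≤ s by lia),
    mul_nonneg (show 0 ≤ s - 1 by lia) (show 0 ≤ g - 1 - s by lia)]

/-- Explicit description of U_{d',s}(BGN) ∩ R. -/
theorem Umap_image_BGN_inter_R (g s d' : ℤ) (hg : 3 ≤ g) (hs : 1 ≤ s) (hs' : s ≤ g - 1)
    (hd' : etaHat g s ≤ d') (hd'1 : g - 1 ≤ d') (hd'2 : d' ≤ min (s + g - 2) (2 * g - 3))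
    (d₁ s₁ : ℤ) (hd₁ : d₁ = 2 * g - 3 - d') (hs₁ : s₁ = s + g - 2 - d') :
    (Umap (g : ℝ) (d' : ℝ) s '' BGN (g : ℝ)) ∩ Rreg (g : ℝ) =
      {p : ℝ × ℝ | (d₁ : ℝ) ≤ p.1 ∧ p.1 < (d₁ : ℝ) + 1 ∧ 0 < p.2 ∧
          p.2 ≤ (1 - (s : ℝ) / (g : ℝ)) * (p.1 - (d₁ : ℝ)) + (s₁ : ℝ)} \
        {((d₁ : ℝ), (s₁ : ℝ))} := by
  have hclif : (2 * s - 2 : ℝ) ≤ d' := by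
    exact_mod_cast two_mul_sub_two_le_of_etaHat_le hs hs' hd'
  have hd'3 : (d' : ℝ) ≤ 2 * g - 3 := by exact_mod_cast hd'2.trans (min_le_right _ _)
  have hd'1r : (g - 1 : ℝ) ≤ d' := by exact_mod_cast hd'1
  have hg0 : (0 : ℝ) < g := by exact_mod_cast (by lia : 0 < g)
  have hs0 : (0 : ℝ) < s := by exact_mod_cast (by lia : 0 < s)
  have hd₁r : (d₁ : ℝ) = 2 * g - 3 - d' := by rw [hd₁]; push_cast; ring
  have hs₁r : (s₁ : ℝ) = s + g - 2 - d' := by rw [hs₁]; push_cast; ring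
  clear hd₁ hs₁ hd' hd'1 hd'2
  ext ⟨x, y⟩
  simp only [Umap, serre, Tmap, BGN, Rreg, Preg, Set.mem_inter_iff, Set.mem_image, Set.mem_sdiff,
    Set.mem_ofPred_eq, Set.mem_singleton_iff, Prod.exists, Prod.mk.injEq]
  constructor
  · rintro ⟨⟨m, l, ⟨⟨hm0, hm1, -, hl⟩, hne⟩, rfl, rfl⟩, ⟨-, -, -, -, hy⟩, -⟩
    refine ⟨⟨by linarith, by linarith, hy, ?_⟩, fun ⟨hx, hy'⟩ => hne ?_⟩
    · have hsl := mul_le_mul_of_nonneg_left hl hs0.le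
      have hval : (s : ℝ) * ((m + g - 1) / g) = s - s / g * (1 - m) := by field_simp; ring
      rw [hd₁r, hs₁r]
      linear_combination hsl + hval
    · have hm : m = 1 := by linarith
      refine ⟨hm, ?_⟩
      have : (s : ℝ) * l = s * 1 := by linarith
      exact mul_left_cancel₀ hs0.ne' this
  · rintro ⟨⟨hx0, hx1, hy0, hy1⟩, hne⟩
    have hsg : 0 ≤ (s : ℝ) / g * (x - d₁) := mul_nonneg (by positivity) (by linarith)
    refine ⟨⟨d₁ + 1 - x, (y - (g - 1) + (d₁ + 1 - x) + d') / s,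
      ⟨⟨by linarith, by linarith, div_pos (by linarith) hs0, ?_⟩, fun ⟨hm, hl⟩ => hne ?_⟩,
      by linarith, by field_simp; ring⟩, ⟨by linarith, by linarith, by linarith, by linarith, hy0⟩,
      by linarith⟩
    · have hval : (d₁ + 1 - x + g - 1) / g * (s : ℝ) = s - s / g * (x - d₁) := by
        field_simp; ring
      rw [div_le_iff₀ hs0, hval]
      linarith
    · rw [div_eq_one_iff_eq hs0.ne'] at hl
      exact ⟨by linarith, by linarith⟩
end

section
/- (Lemma 4.5) Let g ≥ 3 and s, d' be integers with 1 ≤ s ≤ g−1, d' ≥ η̂(s) and g−2 ≤ d' ≤ s+g−3. Set d₁ = 2g−3−d' and s₁ = s+g−2−d'. Then s₁ ≥ 1, d₁−1 ≥ η̂(s₁), and U_{d',s}(M) ∩ R ⊆ T_{d₁−1,s₁}(BGN) ∪ ℓ, where ℓ = {(d₁−1, λ) : 0 < λ < s₁−1}. -/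
/-- The bound `etaHat g s ≤ d` with the ceiling and the denominator cleared. -/
theorem etaHat_le_iff {g s d : ℤ} (hs : 1 ≤ s) :
    etaHat g s ≤ d ↔ (s - 1) * (s + g) ≤ d * s := by
  have hs0 : (0 : ℚ) < s := by exact_mod_cast hs
  rw [etaHat, Int.ceil_le, eta, div_le_iff₀ hs0]
  norm_cast

/-- Lemma 4.5: s₁ ≥ 1, d₁−1 ≥ η̂(s₁), and U_{d',s}(M) ∩ R ⊆ T_{d₁−1,s₁}(BGN) ∪ ℓ. -/
theorem lemma_4_5 (g s d' : ℤ) (hg : 3 ≤ g) (hs : 1 ≤ s) (hs' : s ≤ g - 1)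
    (hd' : etaHat g s ≤ d') (hd'1 : g - 2 ≤ d') (hd'2 : d' ≤ s + g - 3)
    (d₁ s₁ : ℤ) (hd₁ : d₁ = 2 * g - 3 - d') (hs₁ : s₁ = s + g - 2 - d') :
    1 ≤ s₁ ∧ etaHat g s₁ ≤ d₁ - 1 ∧
      (Umap (g : ℝ) (d' : ℝ) s '' Mreg (g : ℝ)) ∩ Rreg (g : ℝ) ⊆
        (Tmap ((d₁ : ℝ) - 1) s₁ '' BGN (g : ℝ)) ∪
          {p : ℝ × ℝ | p.1 = (d₁ : ℝ) - 1 ∧ 0 < p.2 ∧ p.2 < (s₁ : ℝ) - 1} := by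
  have hs₁_pos : 1 ≤ s₁ := by lia
  have hs₁_le : s₁ ≤ s := by lia
  obtain rfl : d' = s + g - 2 - s₁ := by lia
  have hmul : s * s₁ + s ≤ g := by
    have := (etaHat_le_iff hs).1 hd'
    linarith
  refine ⟨hs₁_pos, (etaHat_le_iff hs₁_pos).2 ?_, ?_⟩
  · subst hd₁
    linarith
  have hsum : (s : ℝ) + s₁ ≤ g := by
    have : s + s₁ ≤ g := by nlinarith
    exact_mod_cast this
  have hg0 : (0 : ℝ) < g := by exact_mod_cast (by lia : 0 < g)
  have hs0 : (0 : ℝ) < s := by exact_mod_cast hs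
  have hs₁0 : (0 : ℝ) < s₁ := by exact_mod_cast hs₁_pos
  subst hd₁
  rintro _ ⟨⟨⟨μ, l⟩, hM, rfl⟩, ⟨⟨-, -, -, -, hpos⟩, -⟩⟩
  simp only [Umap, serre, Tmap] at hpos
  push_cast at hpos
  rcases hM with ⟨hμ1, hμ2, -, hl⟩ | ⟨hμ, -, hl⟩
  · left
    dsimp only at hμ1 hμ2 hl
    rw [le_div_iff₀ hg0] at hl
    refine ⟨(2 - μ, (s * l + s₁ + 1 - s - μ) / s₁),
      ⟨⟨?_, ?_, ?_, ?_⟩, fun h => ?_⟩, ?_⟩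
    · dsimp only
      linarith
    · dsimp only
      linarith
    · exact div_pos (by linarith) hs₁0
    · rw [div_le_div_iff₀ hs₁0 hg0]
      dsimp only
      nlinarith [mul_le_mul_of_nonneg_left hl hs0.le,
        mul_le_mul_of_nonneg_left hsum (sub_nonneg.2 hμ1.le)]
    · have : 2 - μ = 1 := congrArg Prod.fst h
      linarith
    · simp only [Umap, serre, Tmap, mul_div_cancel₀ _ hs₁0.ne']
      push_cast
      ext <;> dsimp only <;> ring
  · right
    dsimp only at hμ hl
    subst hμ
    simp only [Umap, serre, Tmap, Set.mem_ofPred_eq]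
    push_cast
    refine ⟨by ring, hpos, ?_⟩
    nlinarith [mul_lt_mul_of_pos_left hl hs0]
end

section
/- (Lemma 4.6) Let g ≥ 3 and s, d' be integers with 1 ≤ s ≤ g−1, d' ≥ η̂(s) and g−1 ≤ d' ≤ s+g−2. Set d₁ = 2g−3−d' and s₁ = s+g−2−d'. If d₁ ≥ η̂(s₁+1), then U_{d',s}(BGN) ∩ R ⊆ T_{d₁,s₁+1}(BGN) ∪ ℓ', where ℓ' = {(d₁, λ) : 0 < λ < s₁}. -/
/-- Lemma 4.6: if d₁ ≥ η̂(s₁+1), then U_{d',s}(BGN) ∩ R ⊆ T_{d₁,s₁+1}(BGN) ∪ ℓ'. -/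
theorem lemma_4_6 (g s d' : ℤ) (hg : 3 ≤ g) (hs : 1 ≤ s) (hs' : s ≤ g - 1)
    (hd' : etaHat g s ≤ d') (hd'1 : g - 1 ≤ d') (hd'2 : d' ≤ s + g - 2)
    (d₁ s₁ : ℤ) (hd₁ : d₁ = 2 * g - 3 - d') (hs₁ : s₁ = s + g - 2 - d')
    (h : etaHat g (s₁ + 1) ≤ d₁) :
    (Umap (g : ℝ) (d' : ℝ) s '' BGN (g : ℝ)) ∩ Rreg (g : ℝ) ⊆
      (Tmap (d₁ : ℝ) (s₁ + 1) '' BGN (g : ℝ)) ∪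
        {p : ℝ × ℝ | p.1 = (d₁ : ℝ) ∧ 0 < p.2 ∧ p.2 < (s₁ : ℝ)} := by
  rintro _ ⟨⟨⟨m, l⟩, ⟨⟨hm0, hm1, hl0, hl⟩, hne⟩, rfl⟩, ⟨⟨-, -, -, -, hy⟩, -⟩⟩
  simp only [Umap, serre, Tmap] at hm0 hm1 hl0 hl hy ⊢
  have hgR : (3 : ℝ) ≤ g := by exact_mod_cast hg
  have hg0 : (0 : ℝ) < g := by linarith
  have hsR : (1 : ℝ) ≤ s := by exact_mod_cast hs
  have hd₁R : (d₁ : ℝ) = 2 * g - 3 - d' := by exact_mod_cast hd₁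
  have hs₁R : (s₁ : ℝ) = s + g - 2 - d' := by exact_mod_cast hs₁
  have hs₁0 : (0 : ℝ) ≤ s₁ := by exact_mod_cast (show 0 ≤ s₁ by omega)
  have hs₁g : (s₁ : ℝ) + 1 ≤ g := by exact_mod_cast (show s₁ + 1 ≤ g by omega)
  have hk : (0 : ℝ) < s₁ + 1 := by linarith
  rw [le_div_iff₀ hg0] at hl
  rcases hm1.eq_or_lt with rfl | hm
  · right
    have hl1 : l < 1 := by
      refine lt_of_le_of_ne (by nlinarith) ?_
      rintro rfl
      exact hne rfl
    refine ⟨by dsimp only; linarith, by dsimp only; linarith, ?_⟩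
    dsimp only
    nlinarith
  · left
    refine ⟨(1 - m, ((s : ℝ) * l + g - 1 - (m + d')) / (s₁ + 1)),
      ⟨⟨by dsimp only; linarith, by dsimp only; linarith, ?_, ?_⟩, ?_⟩, ?_⟩
    · exact div_pos hy hk
    · dsimp only
      rw [div_le_div_iff₀ hk hg0]
      have hsl : (s : ℝ) * (l * g) ≤ s * (m + g - 1) :=
        mul_le_mul_of_nonneg_left hl (by linarith)
      have hslope : ((s₁ : ℝ) + 1) * m ≤ g * m := mul_le_mul_of_nonneg_right hs₁g hm0.le
      have hsm : 0 ≤ (s : ℝ) * (1 - m) := mul_nonneg (by linarith) (by linarith)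
      rw [show (d' : ℝ) = s + g - 2 - s₁ by linarith]
      linarith
    · intro hp
      have := (Prod.mk.inj hp).1
      linarith
    · simp only [Tmap]
      push_cast
      rw [mul_div_cancel₀ _ hk.ne']
      exact Prod.ext (by dsimp only; linarith) rfl
end

section
/- (Lemma 4.7) Let g ≥ 3 and s, d' be integers with 1 ≤ s ≤ g−1, d' ≥ η̂(s) and g−1 ≤ d' ≤ s+g−2. Set d₁ = 2g−3−d' and s₁ = s+g−2−d', and suppose d₁+1 = η̂(s₁+1) ≤ g−1. Then T_{d₁−1,s₁}(M) ⊆ (U_{d',s}(BGN) ∩ R) ∪ ℓ'', where ℓ'' = {(d₁+1, λ) : 0 < λ < s₁}. -/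
/-- A bound `η̂(s) ≤ d` with its denominator cleared. -/
lemma mul_le_of_etaHat_le {g s d : ℤ} (hs : 1 ≤ s) (h : etaHat g s ≤ d) :
    (s - 1) * (s + g) ≤ d * s := by
  have hs0 : (0 : ℚ) < (s : ℚ) := by exact_mod_cast hs
  have h' : eta g s ≤ (d : ℚ) := Int.ceil_le.mp h
  rw [eta, div_le_iff₀ hs0] at h'
  exact_mod_cast h'

lemma etaHat_one (g : ℤ) : etaHat g 1 = 0 := by
  simp [etaHat, eta]

/-- Lemma 4.7: if d₁+1 = η̂(s₁+1) ≤ g−1, then T_{d₁−1,s₁}(M) ⊆ (U_{d',s}(BGN) ∩ R) ∪ ℓ''. -/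
theorem lemma_4_7 (g s d' : ℤ) (hg : 3 ≤ g) (hs : 1 ≤ s) (hs' : s ≤ g - 1)
    (hd' : etaHat g s ≤ d') (hd'1 : g - 1 ≤ d') (hd'2 : d' ≤ s + g - 2)
    (d₁ s₁ : ℤ) (hd₁ : d₁ = 2 * g - 3 - d') (hs₁ : s₁ = s + g - 2 - d')
    (h1 : d₁ + 1 = etaHat g (s₁ + 1)) (h2 : etaHat g (s₁ + 1) ≤ g - 1) :
    Tmap ((d₁ : ℝ) - 1) s₁ '' Mreg (g : ℝ) ⊆
      ((Umap (g : ℝ) (d' : ℝ) s '' BGN (g : ℝ)) ∩ Rreg (g : ℝ)) ∪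
        {p : ℝ × ℝ | p.1 = (d₁ : ℝ) + 1 ∧ 0 < p.2 ∧ p.2 < (s₁ : ℝ)} := by
  have hs₁_nonneg : 0 ≤ s₁ := by lia
  have hs₁_ne : s₁ ≠ 0 := by
    intro h
    rw [h, zero_add, etaHat_one] at h1
    lia
  have hs₁_pos : 1 ≤ s₁ := by lia
  have hmul : s * (s₁ + 1) ≤ g := by
    have := mul_le_of_etaHat_le hs hd'
    subst hs₁
    nlinarith
  have hd₁_lower : s₁ * (1 + s) ≤ d₁ + 1 := by
    have := mul_le_of_etaHat_le (by lia) h1.ge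
    have hs₁_mul : s₁ * (s * (s₁ + 1)) ≤ s₁ * g := by gcongr
    exact le_of_mul_le_mul_right (by linarith) (show 0 < s₁ + 1 by lia)
  have hadd : s + s₁ ≤ g := by nlinarith
  have htwo : 2 * s₁ ≤ d₁ + 1 := by nlinarith
  have hlt : s₁ + 1 ≤ s := by lia
  have hle : d₁ + 1 ≤ g - 1 := by lia
  have hgR : (3 : ℝ) ≤ g := by exact_mod_cast hg
  have hsR : (1 : ℝ) ≤ s := by exact_mod_cast hs
  have hs₁R : (1 : ℝ) ≤ s₁ := by exact_mod_cast hs₁_pos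
  have haddR : (s : ℝ) + s₁ ≤ g := by exact_mod_cast hadd
  have htwoR : 2 * (s₁ : ℝ) ≤ d₁ + 1 := by exact_mod_cast htwo
  have hltR : (s₁ : ℝ) + 1 ≤ s := by exact_mod_cast hlt
  have hleR : (d₁ : ℝ) + 1 ≤ g - 1 := by exact_mod_cast hle
  have hd₁R : (d₁ : ℝ) = 2 * g - 3 - d' := by exact_mod_cast hd₁
  have hs₁_eq : (s₁ : ℝ) = s + g - 2 - d' := by exact_mod_cast hs₁
  have hg0 : (0 : ℝ) < g := by linarith
  have hs0 : (0 : ℝ) < s := by linarith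
  rintro _ ⟨⟨μ, l⟩, ⟨hμ1, hμ2, hl0, hl⟩ | ⟨hμ, hl0, hl1⟩, rfl⟩
  · left
    dsimp only at hμ1 hμ2 hl0 hl
    have hy0 : 0 < (s₁ : ℝ) * l := by positivity
    have hy : (s₁ : ℝ) * l ≤ s₁ + s₁ * ((μ - 1) / g) := by
      calc (s₁ : ℝ) * l ≤ s₁ * ((μ + g - 1) / g) := by gcongr
        _ = s₁ + s₁ * ((μ - 1) / g) := by field_simp; ring
    have hslope : ((s : ℝ) + s₁) * ((μ - 1) / g) ≤ μ - 1 := by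
      rw [← mul_div_assoc, div_le_iff₀ hg0, mul_comm]
      exact mul_le_mul_of_nonneg_left haddR (by linarith)
    have hq0 : 0 < (μ - 1) / g := div_pos (by linarith) hg0
    refine ⟨⟨(2 - μ, (s₁ * l + 1 + s - s₁ - μ) / s),
      ⟨⟨by linarith, by linarith, div_pos (by linarith) hs0, ?_⟩, ?_⟩, ?_⟩, ?_⟩
    · have hrhs : (2 - μ + g - 1) / (g : ℝ) = 1 - (μ - 1) / g := by field_simp; ring
      dsimp only
      rw [hrhs, div_le_iff₀ hs0]
      linarith
    · intro h
      have := congrArg Prod.fst h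
      dsimp only at this
      linarith
    · simp only [Umap, Tmap, serre, Prod.mk.injEq]
      rw [mul_div_cancel₀ _ hs0.ne']
      constructor <;> linarith
    · simp only [Rreg, Preg, Tmap, Set.mem_ofPred_eq]
      have := mul_le_mul_of_nonneg_right hltR hq0.le
      refine ⟨⟨?_, ?_, ?_, ?_, hy0⟩, ?_⟩ <;> linarith
  · right
    dsimp only at hμ hl0 hl1
    refine ⟨?_, ?_, ?_⟩ <;> dsimp only [Tmap]
    · linarith
    · positivity
    · nlinarith
end

section
/- (Proposition 4.11) For every integer g ≥ 3 and every real μ with 0 < μ < 2g−2, one has 0 ≤ ρ_g(μ) − f_g(μ) < 1. -/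
/-- The function ρ_g parametrizing the Brill–Noether curve. -/
noncomputable def rhoG (g μ : ℝ) : ℝ :=
  (Real.sqrt ((μ - g + 1) ^ 2 + 4 * (g - 1)) + μ - g + 1) / 2

lemma le_rhoG {g μ x : ℝ} (h : x * (x - (μ - g + 1)) ≤ g - 1) : x ≤ rhoG g μ := by
  have := Real.le_sqrt_of_sq_le (x := 2 * x - (μ - g + 1))
    (y := (μ - g + 1) ^ 2 + 4 * (g - 1)) (by nlinarith)
  unfold rhoG
  linarith

lemma rhoG_lt {g μ x : ℝ} (hg : 1 < g) (hx : 0 < x)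
    (h : g - 1 < x * (x - (μ - g + 1))) : rhoG g μ < x := by
  have hpos : 0 < x - (μ - g + 1) := pos_of_mul_pos_right (by linarith) hx.le
  have := (Real.sqrt_lt' (x := (μ - g + 1) ^ 2 + 4 * (g - 1))
    (y := 2 * x - (μ - g + 1)) (by linarith)).2 (by nlinarith)
  unfold rhoG
  linarith

lemma rhoG_serre_dual (g μ : ℝ) :
    rhoG g μ = rhoG g (2 * g - 2 - μ) + μ - g + 1 := by
  unfold rhoG
  rw [show (2 * g - 2 - μ - g + 1) ^ 2 = (μ - g + 1) ^ 2 by ring]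
  ring

lemma eta_eq (g : ℤ) {s : ℤ} (hs : 1 ≤ s) :
    ((eta g s : ℚ) : ℝ) = (s : ℝ) + g - 1 - g / s := by
  have : (s : ℝ) ≠ 0 := by
    have : s ≠ 0 := by omega
    exact_mod_cast this
  unfold eta
  push_cast
  field_simp
  ring

lemma le_etaHat (g : ℤ) {s : ℤ} (hs : 1 ≤ s) :
    (s : ℝ) + g - 1 - g / s ≤ etaHat g s := by
  rw [← eta_eq g hs]
  exact_mod_cast Int.le_ceil (eta g s)

lemma etaHat_lt (g : ℤ) {s : ℤ} (hs : 1 ≤ s) :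
    (etaHat g s : ℝ) < (s : ℝ) + g - g / s := by
  have h : ((etaHat g s : ℚ) : ℝ) < ((eta g s + 1 : ℚ) : ℝ) :=
    Rat.cast_lt.2 (Int.ceil_lt_add_one (eta g s))
  push_cast at h
  rw [eta_eq g hs] at h
  linarith

lemma exists_etaHat_lt_le {g : ℤ} (hg : 3 ≤ g) {μ : ℝ} (h0 : 0 < μ) (h1 : μ ≤ (g : ℝ) - 1) :
    ∃ s : ℤ, 1 ≤ s ∧ (etaHat g s : ℝ) < μ ∧ μ ≤ (etaHat g (s + 1) : ℝ) := by
  classical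
  have hgR : (3 : ℝ) ≤ g := by exact_mod_cast hg
  have hex : ∃ k : ℕ, μ ≤ (etaHat g (k + 1) : ℝ) := by
    refine ⟨g.toNat, ?_⟩
    rw [Int.toNat_of_nonneg (by omega)]
    have h := le_etaHat g (s := g + 1) (by omega)
    have : (g : ℝ) / ((g + 1 : ℤ) : ℝ) ≤ 1 := by
      push_cast
      exact (div_le_one (by linarith)).2 (by linarith)
    push_cast at h this
    linarith
  have hspec := Nat.find_spec hex
  have hmin := fun m => Nat.find_min hex (m := m)
  generalize Nat.find hex = k at hspec hmin
  rcases k with _ | k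
  · have : (etaHat g 1 : ℝ) = 0 := by rw [etaHat_one]; simp
    simp only [Nat.cast_zero, zero_add] at hspec
    linarith
  · refine ⟨k + 1, by omega, ?_, by exact_mod_cast hspec⟩
    exact not_le.1 (hmin k (by omega))

lemma first_piece_bounds {g s n μ u : ℝ} (hg : 3 ≤ g) (hs : 1 ≤ s)
    (hn₁ : s + g - 1 - g / s ≤ n) (hn₂ : n < s + g - g / s) (hsg : s < g / s)
    (hu₀ : 0 ≤ u) (hu₁ : u ≤ 1) (hμ : μ = n + 1 - u) :
    s / g * -u + s ≤ rhoG g μ ∧ rhoG g μ < s / g * -u + s + 1 := by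
  obtain ⟨h, hh⟩ : ∃ h, h = g / s := ⟨_, rfl⟩
  obtain ⟨r, hr⟩ : ∃ r, r = s / g := ⟨_, rfl⟩
  have hsh : s * h = g := by rw [hh]; field_simp
  have hrh : r * h = 1 := by rw [hh, hr]; field_simp
  have hr₀ : 0 < r := by rw [hr]; positivity
  rw [← hh] at hn₁ hn₂ hsg
  rw [← hr]
  have hr₁ : r < 1 := by nlinarith
  have hru : r * u ≤ 1 := by nlinarith
  constructor
  · apply le_rhoG
    have hx : 0 ≤ r * -u + s := by linarith
    have key : (r * -u + s) * (r * -u + h - 1 + u) ≤ g - 1 := by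
      have h₁ : 0 ≤ (s - 1) * (1 - u) := mul_nonneg (by linarith) (by linarith)
      have h₂ : 0 ≤ r * u * (s - 1) := mul_nonneg (by positivity) (by linarith)
      have h₃ : 0 ≤ r * u ^ 2 * (1 - r) := mul_nonneg (by positivity) (by linarith)
      linear_combination h₁ + h₂ + h₃ + hsh - u * hrh
    exact (mul_le_mul_of_nonneg_left (by linarith) hx).trans key
  · apply rhoG_lt (by linarith) (by linarith)
    have hx : 0 < r * -u + s + 1 := by linarith
    have key : g - 1 < (r * -u + s + 1) * (r * -u + h - 1 + u) := by
      have h₁ : 0 ≤ u * (1 - r) * (s - r * u) :=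
        mul_nonneg (mul_nonneg hu₀ (by linarith)) (by linarith)
      linear_combination h₁ + hsg - hsh + u * hrh
    exact key.trans (mul_lt_mul_of_pos_left (by linarith) hx)

lemma middle_piece_bounds {g s n m μ t : ℝ} (hg : 3 ≤ g) (hs : 1 ≤ s)
    (hn : s + g - 1 - g / s ≤ n) (hm : m < s + 1 + g - g / (s + 1)) (hsg : s < g / s)
    (ht₀ : 0 ≤ t) (ht₁ : t ≤ 1) (hμ₁ : n + 1 + t ≤ μ) (hμ₂ : μ ≤ m - 2 + t) :
    s / g * t + s ≤ rhoG g μ ∧ rhoG g μ < s / g * t + s + 1 := by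
  obtain ⟨h, hh⟩ : ∃ h, h = g / s := ⟨_, rfl⟩
  obtain ⟨r, hr⟩ : ∃ r, r = s / g := ⟨_, rfl⟩
  obtain ⟨k, hk⟩ : ∃ k, k = g / (s + 1) := ⟨_, rfl⟩
  have hsh : s * h = g := by rw [hh]; field_simp
  have hrh : r * h = 1 := by rw [hh, hr]; field_simp
  have hsk : (s + 1) * k = g := by rw [hk]; field_simp
  have hk₀ : 0 < k := by rw [hk]; positivity
  have hr₀ : 0 < r := by rw [hr]; positivity
  rw [← hh] at hn hsg
  rw [← hk] at hm
  rw [← hr]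
  have hr₁ : r < 1 := by nlinarith
  have hrt : 0 ≤ r * t := by positivity
  constructor
  · apply le_rhoG
    have hx : 0 ≤ r * t + s := by linarith
    have key : (r * t + s) * (r * t + h - 1 - t) ≤ g - 1 := by
      have h₁ : 0 ≤ (s - 1) * (1 + t * (1 - r)) :=
        mul_nonneg (by linarith) (by nlinarith)
      have h₂ : 0 ≤ r * t ^ 2 * (1 - r) := mul_nonneg (by positivity) (by linarith)
      linear_combination h₁ + h₂ + hsh + t * hrh
    exact (mul_le_mul_of_nonneg_left (by linarith) hx).trans key
  · apply rhoG_lt (by linarith) (by linarith)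
    have hx : 0 < r * t + s + 1 := by linarith
    have key : g - 1 < (r * t + s + 1) * (k + 1 - t + r * t) := by
      have h₁ : 0 ≤ r * t * k := by positivity
      have h₂ : 0 ≤ (r * t + s + 1) * (1 - t + r * t) := mul_nonneg hx.le (by linarith)
      linear_combination h₁ + h₂ - hsk
    exact key.trans (mul_lt_mul_of_pos_left (by linarith) hx)

lemma last_piece_bounds {g s m μ t : ℝ} (hg : 3 ≤ g) (hs : 1 ≤ s)
    (hm₁ : s + g - g / (s + 1) ≤ m) (hm₂ : m < s + 1 + g - g / (s + 1)) (hmg : m ≤ g - 1)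
    (ht₀ : 0 ≤ t) (ht₁ : t ≤ 1) (hμ : μ = m - 1 + t) :
    (m - s) / g * t + s ≤ rhoG g μ ∧ rhoG g μ < (m - s) / g * t + s + 1 := by
  obtain ⟨k, hk⟩ : ∃ k, k = g / (s + 1) := ⟨_, rfl⟩
  obtain ⟨τ, hτ⟩ : ∃ τ, τ = t / g := ⟨_, rfl⟩
  obtain ⟨e, he⟩ : ∃ e, e = g - m + s := ⟨_, rfl⟩
  have hsk : (s + 1) * k = g := by rw [hk]; field_simp
  have hgτ : g * τ = t := by rw [hτ]; field_simp
  have hτ₀ : 0 ≤ τ := by rw [hτ]; positivity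
  have hτ₁ : τ ≤ 1 / 3 := by nlinarith
  have hf : (m - s) / g * t = t - e * τ := by
    rw [he, hτ]; field_simp; ring
  rw [← hk] at hm₁ hm₂
  rw [hf]
  have he₂ : 2 ≤ e := by linarith
  have hes : (s + 1) * e ≤ g := by nlinarith
  have hes' : g < (s + 1) * (e + 1) := by nlinarith
  have heg : e ≤ g := by nlinarith
  have heτ : e * τ ≤ t := by nlinarith
  constructor
  · apply le_rhoG
    have hx : t - e * τ + s - (μ - g + 1) = e * (1 - τ) := by rw [hμ, he]; ring
    rw [hx]
    have h₁ : 0 ≤ (g - (s + 1) * e) * (1 - τ) := mul_nonneg (by linarith) (by linarith)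
    have h₂ : 0 ≤ (1 - t) * (e * (1 - τ) - 1) := mul_nonneg (by linarith) (by nlinarith)
    have h₃ : 0 ≤ e ^ 2 * τ * (1 - τ) := mul_nonneg (by positivity) (by linarith)
    linear_combination h₁ + h₂ + h₃ - hgτ
  · have hx₀ : 0 < t - e * τ + s + 1 := by linarith
    apply rhoG_lt (by linarith) hx₀
    have hx : t - e * τ + s + 1 - (μ - g + 1) = 1 + e * (1 - τ) := by rw [hμ, he]; ring
    rw [hx]
    have h₁ : 0 ≤ (t - e * τ) * (1 + e * (1 - τ)) :=
      mul_nonneg (by linarith) (by nlinarith)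
    have h₂ : 0 ≤ (g - (s + 1) * e) * τ := mul_nonneg (by linarith) hτ₀
    linear_combination h₁ + h₂ + hes' + hgτ + ht₁

/-- Proposition 4.11: the upper boundary function f_g of the region BMNO satisfies
0 ≤ ρ_g(μ) − f_g(μ) < 1 for all 0 < μ < 2g−2.  Here f_g is specified by its defining
clauses: for 0 < μ ≤ g−1 it is given piecewise (in terms of the unique integer s ≥ 1
with η̂(s) < μ ≤ η̂(s+1)), and for g−1 < μ < 2g−2 its graph is invariant under the
Serre duality map σ(μ,λ) = (2g−2−μ, λ+g−1−μ). -/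
theorem prop_4_11 (g : ℤ) (hg : 3 ≤ g) (f : ℝ → ℝ)
    (hf1 : ∀ (μ : ℝ) (s : ℤ), 1 ≤ s → 0 < μ → μ ≤ (g : ℝ) - 1 →
      (etaHat g s : ℝ) < μ → μ ≤ (etaHat g (s + 1) : ℝ) →
      ((μ ≤ (etaHat g s : ℝ) + 1 →
          f μ = ((s : ℝ) / (g : ℝ)) * (μ - (⌈μ⌉ : ℝ)) + (s : ℝ)) ∧
       ((etaHat g s : ℝ) + 1 < μ → μ ≤ (etaHat g (s + 1) : ℝ) - 1 →
          f μ = ((s : ℝ) / (g : ℝ)) * (μ - (⌈μ⌉ : ℝ) + 1) + (s : ℝ)) ∧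
       ((etaHat g (s + 1) : ℝ) - 1 < μ →
          f μ = (((etaHat g (s + 1) : ℝ) - (s : ℝ)) / (g : ℝ)) * (μ - (⌈μ⌉ : ℝ) + 1)
            + (s : ℝ))))
    (hf2 : ∀ μ : ℝ, (g : ℝ) - 1 < μ → μ < 2 * (g : ℝ) - 2 →
      f μ = f (2 * (g : ℝ) - 2 - μ) + μ - (g : ℝ) + 1) :
    ∀ μ : ℝ, 0 < μ → μ < 2 * (g : ℝ) - 2 →
      0 ≤ rhoG (g : ℝ) μ - f μ ∧ rhoG (g : ℝ) μ - f μ < 1 := by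
  have hgR : (3 : ℝ) ≤ g := by exact_mod_cast hg
  have left : ∀ μ : ℝ, 0 < μ → μ ≤ (g : ℝ) - 1 →
      0 ≤ rhoG (g : ℝ) μ - f μ ∧ rhoG (g : ℝ) μ - f μ < 1 := by
    intro μ h0 h1
    suffices h : f μ ≤ rhoG (g : ℝ) μ ∧ rhoG (g : ℝ) μ < f μ + 1 from
      ⟨by linarith [h.1], by linarith [h.2]⟩
    obtain ⟨s, hs, hlt, hle⟩ := exists_etaHat_lt_le hg h0 h1
    obtain ⟨hfirst, hmid, hlast⟩ := hf1 μ s hs h0 h1 hlt hle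
    have hsR : (1 : ℝ) ≤ s := by exact_mod_cast hs
    have hn₁ := le_etaHat g hs
    have hn₂ := etaHat_lt g hs
    have hm₁ := le_etaHat g (s := s + 1) (by omega)
    have hm₂ := etaHat_lt g (s := s + 1) (by omega)
    push_cast at hm₁ hm₂
    have hsg : (s : ℝ) < g / s := by linarith
    have hc₁ := Int.le_ceil μ
    have hc₂ := Int.ceil_lt_add_one μ
    by_cases hA : μ ≤ (etaHat g s : ℝ) + 1
    · rw [hfirst hA]
      have hceil : ⌈μ⌉ = etaHat g s + 1 := by
        rw [Int.ceil_eq_iff]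
        push_cast
        constructor <;> linarith
      have hceilR : (⌈μ⌉ : ℝ) = etaHat g s + 1 := by exact_mod_cast hceil
      rw [show μ - (⌈μ⌉ : ℝ) = -(⌈μ⌉ - μ) by ring]
      exact first_piece_bounds hgR hsR hn₁ hn₂ hsg (by linarith) (by linarith) (by linarith)
    rw [not_le] at hA
    by_cases hB : μ ≤ (etaHat g (s + 1) : ℝ) - 1
    · rw [hmid hA hB]
      have hceil₁ : etaHat g s + 2 ≤ ⌈μ⌉ := by
        have : etaHat g s + 1 < ⌈μ⌉ := Int.lt_ceil.2 (by exact_mod_cast hA)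
        omega
      have hceil₂ : ⌈μ⌉ ≤ etaHat g (s + 1) - 1 := Int.ceil_le.2 (by exact_mod_cast hB)
      have hceilR₁ : (etaHat g s : ℝ) + 2 ≤ ⌈μ⌉ := by exact_mod_cast hceil₁
      have hceilR₂ : (⌈μ⌉ : ℝ) ≤ etaHat g (s + 1) - 1 := by exact_mod_cast hceil₂
      exact middle_piece_bounds hgR hsR hn₁ hm₂ hsg (by linarith) (by linarith)
        (by linarith) (by linarith)
    · rw [not_le] at hB
      rw [hlast hB]
      have hceil : ⌈μ⌉ = etaHat g (s + 1) := by
        rw [Int.ceil_eq_iff]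
        constructor <;> linarith
      have hceilR : (⌈μ⌉ : ℝ) = etaHat g (s + 1) := by exact_mod_cast hceil
      have hceil_le : ⌈μ⌉ ≤ g - 1 := Int.ceil_le.2 (by exact_mod_cast h1)
      have hmg : (etaHat g (s + 1) : ℝ) ≤ g - 1 := by
        rw [← hceilR]
        exact_mod_cast hceil_le
      exact last_piece_bounds hgR hsR (by linarith) hm₂ hmg (by linarith) (by linarith)
        (by linarith)
  intro μ h0 h2
  rcases le_or_gt μ ((g : ℝ) - 1) with h1 | h1
  · exact left μ h0 h1
  · rw [hf2 μ h1 h2, rhoG_serre_dual (g : ℝ) μ]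
    have := left (2 * (g : ℝ) - 2 - μ) (by linarith) (by linarith)
    constructor <;> linarith [this.1, this.2]
end

section
/- Let g ≥ 2 be a real number, s an integer with 1 ≤ s ≤ g, and d' a real number with d' ≥ (s−1)(s+g)/s. Then for every (μ,λ) ∈ ℝ² with 0 < μ ≤ 2 and 0 < λ ≤ (μ+g−1)/g, one has ρ̃(μ+d', sλ) ≥ ρ̃(μ,λ). In particular every point of T_{d',s}(BGN ∪ M) lies on or below the Brill–Noether curve. -/
/-- The Brill–Noether function ρ̃(μ,λ) = (g−1) − λ(λ−μ+g−1). -/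
def rhoTilde (g : ℝ) (p : ℝ × ℝ) : ℝ := (g - 1) - p.2 * (p.2 - p.1 + g - 1)

/-- The function ρ̃ is nonnegative for μ ≤ 2, 0 < λ ≤ (μ+g−1)/g. -/
lemma rhoTilde_nonneg {g μ lam : ℝ} (hg : 2 ≤ g) (hμ2 : μ ≤ 2)
    (hl : 0 < lam) (hlu : lam ≤ (μ + g - 1) / g) : 0 ≤ rhoTilde g (μ, lam) := by
  have hg0 : 0 < g := by linarith
  obtain ⟨v, rfl⟩ : ∃ v, μ = 1 + g * v := ⟨(μ - 1) / g, by field_simp; ring⟩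
  have hu : (1 + g * v + g - 1) / g = 1 + v := by field_simp; ring
  rw [hu] at hlu
  have hv : v ≤ 1 := by nlinarith
  have h1 : lam * (lam - (1 + g * v) + g - 1) ≤ lam * ((g - 1) * (1 - v)) := by
    apply mul_le_mul_of_nonneg_left _ hl.le
    linarith
  have h2 : lam * ((g - 1) * (1 - v)) ≤ (1 + v) * ((g - 1) * (1 - v)) :=
    mul_le_mul_of_nonneg_right hlu (mul_nonneg (by linarith) (by linarith))
  have h3 : 0 ≤ (g - 1) * v ^ 2 := mul_nonneg (by linarith) (sq_nonneg v)
  simp only [rhoTilde]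
  linarith

/-- Applying T_{d',s} does not decrease ρ̃ on the trapezoid 0 < μ ≤ 2, 0 < λ ≤ (μ+g−1)/g. -/
lemma rhoTilde_le_of_mem_trapezoid {g s d' μ lam : ℝ} (hg : 2 ≤ g) (hs : 1 ≤ s) (hsg : s ≤ g)
    (hd' : (s - 1) * (s + g) / s ≤ d') (hμ : 0 < μ) (hμ2 : μ ≤ 2) (hl : 0 < lam)
    (hlu : lam ≤ (μ + g - 1) / g) : rhoTilde g (μ, lam) ≤ rhoTilde g (μ + d', s * lam) := by
  have hg0 : 0 < g := by linarith
  rw [div_le_iff₀ (by linarith)] at hd'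
  rw [le_div_iff₀ hg0] at hlu
  have key : (s + 1) * lam ≤ μ + s + 1 := by
    refine le_of_mul_le_mul_right ?_ hg0
    have h1 := mul_le_mul_of_nonneg_left hlu (by linarith : 0 ≤ s + 1)
    rcases le_total μ 1 with h | h
    · nlinarith [mul_nonneg (by linarith : 0 ≤ s + 1) (by linarith : 0 ≤ 1 - μ), mul_pos hμ hg0]
    · nlinarith [mul_nonneg (by linarith : 0 ≤ g - s) (by linarith : 0 ≤ μ - 1)]
  have h2 := mul_le_mul_of_nonneg_left key (by linarith : 0 ≤ s - 1)
  have h3 : 0 ≤ (s - 1) * μ + s * d' - (s - 1) * (g - 1) - (s - 1) * (s + 1) * lam := by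
    linarith
  have h4 := mul_nonneg hl.le h3
  simp only [rhoTilde]
  linarith

/-- ρ̃(μ+d', sλ) ≥ ρ̃(μ,λ) for 0 < μ ≤ 2, 0 < λ ≤ (μ+g−1)/g, whenever
d' ≥ (s−1)(s+g)/s; in particular T_{d',s}(BGN ∪ M) lies on or below the
Brill–Noether curve. -/
theorem rhoTilde_le_rhoTilde_Tmap (g : ℝ) (hg : 2 ≤ g) (s : ℤ) (hs : 1 ≤ s)
    (hsg : (s : ℝ) ≤ g) (d' : ℝ) (hd' : ((s : ℝ) - 1) * ((s : ℝ) + g) / (s : ℝ) ≤ d') :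
    (∀ μ lam : ℝ, 0 < μ → μ ≤ 2 → 0 < lam → lam ≤ (μ + g - 1) / g →
        rhoTilde g (μ, lam) ≤ rhoTilde g (μ + d', (s : ℝ) * lam)) ∧
    (∀ p ∈ BGN g ∪ Mreg g, 0 ≤ rhoTilde g (Tmap d' s p)) := by
  have hs' : (1 : ℝ) ≤ s := by exact_mod_cast hs
  have hle (μ lam : ℝ) (h1 : 0 < μ) (h2 : μ ≤ 2) (h3 : 0 < lam) (h4 : lam ≤ (μ + g - 1) / g) :=
    rhoTilde_le_of_mem_trapezoid hg hs' hsg hd' h1 h2 h3 h4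
  refine ⟨hle, ?_⟩
  rintro ⟨μ, lam⟩ hp
  have hmem : 0 < μ ∧ μ ≤ 2 ∧ 0 < lam ∧ lam ≤ (μ + g - 1) / g := by
    rcases hp with ⟨⟨h1, h2, h3, h4⟩, -⟩ | ⟨h1, h2, h3, h4⟩ | ⟨h1, h2, h3⟩
    · exact ⟨h1, h2.trans one_le_two, h3, h4⟩
    · exact ⟨one_pos.trans h1, h2.le, h3, h4⟩
    · dsimp only at h1 h2 h3
      subst h1
      refine ⟨two_pos, le_rfl, h2, h3.le.trans ?_⟩
      rw [le_div_iff₀ (by linarith)]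
      linarith
  obtain ⟨h1, h2, h3, h4⟩ := hmem
  exact (rhoTilde_nonneg hg h2 h3 h4).trans (hle μ lam h1 h2 h3 h4)
end

section
/- Let g ≥ 3 and s ≥ 1 be integers with η̂(s+1) ≤ g−1. Then ρ_g(η̂(s+1)) − ((η̂(s+1)−s)/g + s) < 1 and ρ_g(η̂(s+1)) − (s+1 − (s+1)/g) < 1. -/
theorem rhoG_lt_iff {g μ x : ℝ} (hx : 0 < 2 * x - (μ - g + 1)) :
    rhoG g μ < x ↔ g - 1 < x * (x - (μ - g + 1)) := by
  have hsqrt : rhoG g μ < x ↔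
      √((μ - g + 1) ^ 2 + 4 * (g - 1)) < 2 * x - (μ - g + 1) := by
    unfold rhoG
    constructor <;> intro h <;> linarith
  rw [hsqrt, Real.sqrt_lt' hx]
  constructor <;> intro h <;> nlinarith

/-- If `g = q t + r` with `r ≤ t - 1` and `0 < t ≤ q`, then `ρ_g (t - 1 + g - q)` exceeds `t` by
less than `1 / 2`. -/
theorem rhoG_lt_add_of_half_le {g t q δ : ℝ} (ht : 0 < t) (hq : t ≤ q)
    (hg : g ≤ q * t + t - 1) (hδ : 1 / 2 ≤ δ) :
    rhoG g (t - 1 + g - q) < t + δ := by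
  rw [rhoG_lt_iff (by linarith)]
  nlinarith [mul_nonneg (sub_nonneg.2 hδ) (by linarith : 0 ≤ t + q)]

theorem etaHat_succ_bounds (g : ℤ) {s : ℤ} (hs : 0 ≤ s) :
    (s + g - etaHat g (s + 1)) * (s + 1) ≤ g ∧
      g < (s + g - etaHat g (s + 1) + 1) * (s + 1) := by
  have hs' : (0 : ℚ) < s + 1 := by exact_mod_cast Int.lt_add_one_of_le hs
  have hlt : (etaHat g (s + 1) : ℚ) < eta g (s + 1) + 1 := Int.ceil_lt_add_one _
  have hle : eta g (s + 1) ≤ (etaHat g (s + 1) : ℚ) := Int.le_ceil _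
  have heta : eta g (s + 1) * (s + 1) = s * (s + 1 + g) := by
    unfold eta
    push_cast
    field_simp
    ring
  have hlt' := mul_lt_mul_of_pos_right hlt hs'
  have hle' := mul_le_mul_of_nonneg_right hle hs'.le
  constructor
  · have : ((s : ℚ) + g - etaHat g (s + 1)) * (s + 1) ≤ g := by linarith
    exact_mod_cast this
  · have : (g : ℚ) < (s + g - etaHat g (s + 1) + 1) * (s + 1) := by linarith
    exact_mod_cast this

/-- The two key inequalities from the proof of Proposition 4.11. -/
theorem rhoG_etaHat_inequalities (g s : ℤ) (hg : 3 ≤ g) (hs : 1 ≤ s)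
    (h : etaHat g (s + 1) ≤ g - 1) :
    rhoG (g : ℝ) ((etaHat g (s + 1) : ℝ)) -
        (((etaHat g (s + 1) : ℝ) - (s : ℝ)) / (g : ℝ) + (s : ℝ)) < 1 ∧
    rhoG (g : ℝ) ((etaHat g (s + 1) : ℝ)) -
        ((s : ℝ) + 1 - ((s : ℝ) + 1) / (g : ℝ)) < 1 := by
  obtain ⟨hle, hlt⟩ := etaHat_succ_bounds g (zero_le_one.trans hs)
  generalize etaHat g (s + 1) = m at *
  obtain ⟨q, rfl⟩ : ∃ q, m = s + g - q := ⟨s + g - m, by ring⟩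
  have hq : s + 1 ≤ q := by linarith
  have hg' : g ≤ q * (s + 1) + (s + 1) - 1 := by linarith
  have hqg : 2 * q ≤ g := by nlinarith
  have hg0 : (0 : ℝ) < g := by exact_mod_cast (by linarith : 0 < g)
  have hq' : (s : ℝ) + 1 ≤ q := by exact_mod_cast hq
  have hgR : (g : ℝ) ≤ q * (s + 1) + (s + 1) - 1 := by exact_mod_cast hg'
  have hqgR : 2 * (q : ℝ) ≤ g := by exact_mod_cast hqg
  have hs0 : (0 : ℝ) < s + 1 := by exact_mod_cast (by linarith : 0 < s + 1)
  have key : ∀ δ : ℝ, 1 / 2 ≤ δ → rhoG g (s + g - q) < s + 1 + δ := fun δ hδ => by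
    have := rhoG_lt_add_of_half_le hs0 hq' hgR hδ
    rwa [add_sub_cancel_right] at this
  push_cast
  constructor
  · have hδ : 1 / 2 ≤ ((s : ℝ) + g - q - s) / g := by
      rw [le_div_iff₀ hg0]
      linarith
    linarith [key _ hδ]
  · have hδ : ((s : ℝ) + 1) / g ≤ 1 / 2 := by
      rw [div_le_iff₀ hg0]
      linarith
    linarith [key (1 - ((s : ℝ) + 1) / g) (by linarith)]
end

section
/- For every integer g ≥ 3 and every real μ with 0 < μ < 2g−2 that is not an even integer, one has h_g(2g−2−μ) = h_g(μ) + g−1−μ; that is, the graph of h_g is invariant under the Serre duality map σ(μ,λ) = (2g−2−μ, λ+g−1−μ) away from even integer abscissae. -/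
/-- Serre-duality invariance of the graph of the upper boundary function h_g of the
hyperelliptic region BMNO_h, away from even integer abscissae.  Here h_g is specified
by its defining clauses: h_g(μ) = (s/g)(μ−2s+1) + s for μ ∈ (2s−2, 2s], where s is the
unique integer with 1 ≤ s ≤ g−1 and 2s−2 < μ ≤ 2s. -/
theorem hg_serre_invariant (g : ℤ) (hg : 3 ≤ g) (h : ℝ → ℝ)
    (hh : ∀ (μ : ℝ) (s : ℤ), 1 ≤ s → s ≤ g - 1 →
      2 * (s : ℝ) - 2 < μ → μ ≤ 2 * (s : ℝ) →
      h μ = ((s : ℝ) / (g : ℝ)) * (μ - 2 * (s : ℝ) + 1) + (s : ℝ)) :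
    ∀ μ : ℝ, 0 < μ → μ < 2 * (g : ℝ) - 2 → (∀ k : ℤ, μ ≠ 2 * (k : ℝ)) →
      h (2 * (g : ℝ) - 2 - μ) = h μ + (g : ℝ) - 1 - μ := by
  intro μ hμ0 hμ1 hne
  obtain ⟨s, hs⟩ : ∃ s : ℤ, s = ⌈μ / 2⌉ := ⟨_, rfl⟩
  have hle : μ ≤ 2 * (s : ℝ) := by
    have := Int.le_ceil (μ / 2)
    rw [← hs] at this
    linarith
  have hlt : 2 * (s : ℝ) - 2 < μ := by
    have := Int.ceil_lt_add_one (μ / 2)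
    rw [← hs] at this
    linarith
  have hlt' : μ < 2 * (s : ℝ) := lt_of_le_of_ne hle (hne s)
  have hs1 : 1 ≤ s := by
    have : (0 : ℝ) < s := by linarith
    exact_mod_cast this
  have hsg : s ≤ g - 1 := by
    have : (s : ℝ) < g := by linarith
    have : s < g := by exact_mod_cast this
    omega
  have hg0 : (g : ℝ) ≠ 0 := by
    have : g ≠ 0 := by omega
    exact_mod_cast this
  rw [hh μ s hs1 hsg hlt hle,
    hh (2 * (g : ℝ) - 2 - μ) (g - s) (by omega) (by omega)
      (by push_cast; linarith) (by push_cast; linarith)]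
  push_cast
  field_simp
  ring
end
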